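/- arXiv:2506.04022 — 2 statements merged into one kernel-verified Lean document; each statement's English description precedes it below -/
import Mathlib

section
/- Let Ω ⊆ ℝ^m be an open convex set containing 0, and let g : ℝ^m → ℝⁿ be twice continuously differentiable on Ω with ‖D²g(y)‖ ≤ η for all y ∈ Ω. Set θ⁰ := g(0) and J := Dg(0). Given x^(1), …, x^(m) ∈ Ω, set θ^(i) := g(x^(i)), and define the linear maps D(α) := Σᵢ αᵢ·(θ^(i) − θ⁰), X(α) := Σᵢ αᵢ·x^(i), and E(α) := Σᵢ αᵢ·(θ^(i) − θ⁰ − J(x^(i))), and the extrapolated point θ̃(α) := θ⁰ + D(α). Then for every α ∈ ℝ^m with X(α) ∈ Ω, ‖θ̃(α) − g(X(α))‖ ≤ ‖E‖·‖α‖ + (η/2)·‖X(α)‖², where ‖E‖ is the operator norm of E. -/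
theorem lle_taylor_aux {V W : Type*} [NormedAddCommGroup V] [NormedSpace ℝ V]
    [NormedAddCommGroup W] [NormedSpace ℝ W] (Ω : Set V)
    (hΩopen : IsOpen Ω) (hΩconv : Convex ℝ Ω) (h0 : (0 : V) ∈ Ω)
    (g : V → W) (η : ℝ) (hg : ContDiffOn ℝ 2 g Ω)
    (hD2 : ∀ y ∈ Ω, ‖fderiv ℝ (fderiv ℝ g) y‖ ≤ η) (z : V) (hz : z ∈ Ω) :
    ‖g z - g 0 - fderiv ℝ g 0 z‖ ≤ η / 2 * ‖z‖ ^ 2 := by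
  have hdg : ∀ y ∈ Ω, DifferentiableAt ℝ g y := fun y hy =>
    (hg.contDiffAt (hΩopen.mem_nhds hy)).differentiableAt (by norm_num)
  have hdg2 : ∀ y ∈ Ω, DifferentiableAt ℝ (fderiv ℝ g) y := fun y hy =>
    ((hg.contDiffAt (hΩopen.mem_nhds hy)).fderiv_right (m := 1) (by norm_num)).differentiableAt
      (by norm_num)
  have hlip : ∀ y ∈ Ω, ‖fderiv ℝ g y - fderiv ℝ g 0‖ ≤ η * ‖y‖ := fun y hy => by
    simpa using hΩconv.norm_image_sub_le_of_norm_fderiv_le hdg2 hD2 h0 hy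
  have hseg : ∀ t ∈ Set.Icc (0 : ℝ) 1, t • z ∈ Ω := fun t ht =>
    hΩconv.smul_mem_of_zero_mem h0 hz ht
  have hder : ∀ t ∈ Set.Icc (0 : ℝ) 1,
      HasDerivAt (fun t : ℝ => g (t • z) - g 0 - t • fderiv ℝ g 0 z)
        (fderiv ℝ g (t • z) z - fderiv ℝ g 0 z) t := fun t ht => by
    have h1 : HasDerivAt (fun t : ℝ => t • z) z t := by
      simpa using (hasDerivAt_id t).smul_const z
    have h2 := (hdg _ (hseg t ht)).hasFDerivAt.comp_hasDerivAt t h1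
    have h3 : HasDerivAt (fun t : ℝ => t • fderiv ℝ g 0 z) (fderiv ℝ g 0 z) t := by
      simpa using (hasDerivAt_id t).smul_const (fderiv ℝ g 0 z)
    exact (h2.sub_const (g 0)).sub h3
  have hB : ∀ t : ℝ, HasDerivAt (fun t : ℝ => η / 2 * ‖z‖ ^ 2 * t ^ 2) (η * ‖z‖ ^ 2 * t) t :=
    fun t => by
      have := (hasDerivAt_pow 2 t).const_mul (η / 2 * ‖z‖ ^ 2)
      refine this.congr_deriv ?_
      norm_num
      ring
  have := image_norm_le_of_norm_deriv_right_le_deriv_boundary (a := 0) (b := 1)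
    (f := fun t : ℝ => g (t • z) - g 0 - t • fderiv ℝ g 0 z)
    (f' := fun t : ℝ => fderiv ℝ g (t • z) z - fderiv ℝ g 0 z)
    (fun t ht => (hder t ht).continuousAt.continuousWithinAt)
    (fun t ht => (hder t ⟨ht.1, ht.2.le⟩).hasDerivWithinAt)
    (B := fun t : ℝ => η / 2 * ‖z‖ ^ 2 * t ^ 2) (by simp) hB
    (fun t ht => by
      have h1 := hlip _ (hseg t ⟨ht.1, ht.2.le⟩)
      have h2 := (fderiv ℝ g (t • z) - fderiv ℝ g 0).le_opNorm z
      rw [norm_smul, Real.norm_of_nonneg ht.1] at h1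
      have h3 := mul_le_mul_of_nonneg_right h1 (norm_nonneg z)
      have h4 := h2.trans h3
      rw [sub_apply] at h4
      exact h4.trans (le_of_eq (by ring)))
    (Set.right_mem_Icc.2 zero_le_one)
  simpa using this

/-- **Parameter-space error of the locally linear extrapolation.**
With `g` `C²` on an open convex `Ω ∋ 0`, `‖D²g‖ ≤ η` on `Ω`, base point
`θ⁰ = g 0`, retrained points `θ^(i) = g (x^(i))`, direction map
`D(α) = Σᵢ αᵢ (θ^(i) − θ⁰)`, coordinate map `X(α) = Σᵢ αᵢ x^(i)`, and error map
`E(α) = Σᵢ αᵢ (θ^(i) − θ⁰ − J x^(i))` with `J = Dg(0)`, the extrapolation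
`θ̃(α) = θ⁰ + D(α)` satisfies
`‖θ̃(α) − g(X(α))‖ ≤ ‖E‖‖α‖ + (η/2)‖X(α)‖²` whenever `X(α) ∈ Ω`. -/
theorem lle_parameter_error_bound
    {m n : ℕ} (Ω : Set (EuclideanSpace ℝ (Fin m)))
    (hΩopen : IsOpen Ω) (hΩconv : Convex ℝ Ω) (h0 : (0 : EuclideanSpace ℝ (Fin m)) ∈ Ω)
    (g : EuclideanSpace ℝ (Fin m) → EuclideanSpace ℝ (Fin n))
    (η : ℝ)
    (hg : ContDiffOn ℝ 2 g Ω)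
    (hD2 : ∀ y ∈ Ω, ‖fderiv ℝ (fderiv ℝ g) y‖ ≤ η)
    (x : Fin m → EuclideanSpace ℝ (Fin m)) (hx : ∀ i, x i ∈ Ω)
    (E : EuclideanSpace ℝ (Fin m) →L[ℝ] EuclideanSpace ℝ (Fin n))
    (hE : ∀ α : EuclideanSpace ℝ (Fin m),
      E α = ∑ i, α i • (g (x i) - g 0 - fderiv ℝ g 0 (x i))) :
    ∀ α : EuclideanSpace ℝ (Fin m), (∑ i, α i • x i) ∈ Ω →
      ‖(g 0 + ∑ i, α i • (g (x i) - g 0)) - g (∑ i, α i • x i)‖ ≤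
        ‖E‖ * ‖α‖ + η / 2 * ‖∑ i, α i • x i‖ ^ 2 := by
  intro α hX
  have key := lle_taylor_aux Ω hΩopen hΩconv h0 g η hg hD2 _ hX
  have hsplit : (g 0 + ∑ i, α i • (g (x i) - g 0)) - g (∑ i, α i • x i)
      = E α - (g (∑ i, α i • x i) - g 0 - fderiv ℝ g 0 (∑ i, α i • x i)) := by
    rw [hE, map_sum]
    simp only [map_smul, smul_sub, Finset.sum_sub_distrib]
    abel
  rw [hsplit]
  exact (norm_sub_le _ _).trans (add_le_add (E.le_opNorm α) key)
end

section
/- Let Ω ⊆ ℝ^m be an open convex set containing 0, and let g : ℝ^m → ℝⁿ be twice continuously differentiable on Ω with ‖D²g(y)‖ ≤ η for all y ∈ Ω. Set θ⁰ := g(0), and given x^(1), …, x^(m) ∈ Ω set θ^(i) := g(x^(i)), D(α) := Σᵢ αᵢ·(θ^(i) − θ⁰), X(α) := Σᵢ αᵢ·x^(i), and θ̃(α) := θ⁰ + D(α). Let S ⊆ ℝⁿ be a set containing g(Ω), let L_V ≥ 0, and let V : ℝⁿ → ℝ^d be Lipschitz on S with constant L_V. Define the local Pareto patch P := V '' (g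 '' Ω) ⊆ ℝ^d. Then for every α ∈ ℝ^m such that X(α) ∈ Ω and θ̃(α) ∈ S, the distance from the performance of the extrapolated policy to P is bounded by dist(V(θ̃(α)), P) ≤ (L_V · η / 2) · (max_{1 ≤ i ≤ m} ‖x^(i)‖²) · (√m · ‖α‖ + m · ‖α‖²). In particular the extrapolation error converges to zero at first order as ‖α‖ → 0 and grows at most at second order as ‖α‖ grows. -/
theorem lle_taylor {E F : Type*} [NormedAddCommGroup E] [NormedSpace ℝ E]
    [NormedAddCommGroup F] [NormedSpace ℝ F] (Ω : Set E)
    (hΩopen : IsOpen Ω) (hΩconv : Convex ℝ Ω) (h0 : (0 : E) ∈ Ω) (g : E → F) (η : ℝ)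
    (hg : ContDiffOn ℝ 2 g Ω)
    (hD2 : ∀ y ∈ Ω, ‖fderiv ℝ (fderiv ℝ g) y‖ ≤ η) (x : E) (hx : x ∈ Ω) :
    ‖g x - g 0 - fderiv ℝ g 0 x‖ ≤ η / 2 * ‖x‖ ^ 2 := by
  have hd : ∀ y ∈ Ω, DifferentiableAt ℝ g y := fun y hy =>
    (hg.differentiableOn (by norm_num)).differentiableAt (hΩopen.mem_nhds hy)
  have hdd : ∀ y ∈ Ω, DifferentiableAt ℝ (fderiv ℝ g) y := fun y hy =>
    ((hg.fderiv_of_isOpen hΩopen (m := 1) (by norm_num)).differentiableOn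
      (by norm_num)).differentiableAt (hΩopen.mem_nhds hy)
  have hmem : ∀ t ∈ Set.Icc (0 : ℝ) 1, t • x ∈ Ω := fun t ht =>
    hΩconv.smul_mem_of_zero_mem h0 hx ht
  have hder : ∀ t ∈ Set.Icc (0 : ℝ) 1,
      HasDerivAt (fun t : ℝ => g (t • x) - g 0 - t • fderiv ℝ g 0 x)
        (fderiv ℝ g (t • x) x - fderiv ℝ g 0 x) t := by
    intro t ht
    have h1 : HasDerivAt (fun t : ℝ => t • x) x t := by
      simpa using (hasDerivAt_id t).smul_const x
    have h2 := (hd _ (hmem t ht)).hasFDerivAt.comp_hasDerivAt t h1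
    have h3 : HasDerivAt (fun t : ℝ => t • fderiv ℝ g 0 x) (fderiv ℝ g 0 x) t := by
      simpa using (hasDerivAt_id t).smul_const (fderiv ℝ g 0 x)
    exact (h2.sub_const (g 0)).sub h3
  have key := image_norm_le_of_norm_deriv_right_le_deriv_boundary
    (f := fun t : ℝ => g (t • x) - g 0 - t • fderiv ℝ g 0 x)
    (f' := fun t : ℝ => fderiv ℝ g (t • x) x - fderiv ℝ g 0 x) (a := 0) (b := 1)
    (B := fun t => η / 2 * ‖x‖ ^ 2 * t ^ 2) (B' := fun t => η * ‖x‖ ^ 2 * t)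
    (fun t ht => (hder t ht).continuousAt.continuousWithinAt)
    (fun t ht => (hder t (Set.Ico_subset_Icc_self ht)).hasDerivWithinAt)
    (by simp)
    (fun t => by
      have := (hasDerivAt_pow 2 t).const_mul (η / 2 * ‖x‖ ^ 2)
      refine this.congr_deriv ?_
      norm_num
      ring)
    (fun t ht => by
      have ht' := Set.Ico_subset_Icc_self ht
      have h := hΩconv.norm_image_sub_le_of_norm_fderiv_le hdd hD2 h0 (hmem t ht')
      rw [sub_zero, norm_smul, Real.norm_of_nonneg ht'.1] at h
      rw [← ContinuousLinearMap.sub_apply]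
      calc _ ≤ _ := ContinuousLinearMap.le_opNorm _ _
        _ ≤ η * (t * ‖x‖) * ‖x‖ := by gcongr
        _ = _ := by ring)
  simpa using key (Set.right_mem_Icc.mpr zero_le_one)

/-- **Local Pareto error of LLE.**
With `g` `C²` on an open convex `Ω ∋ 0` with `‖D²g‖ ≤ η`, retrained points
`θ^(i) = g (x^(i))`, extrapolation `θ̃(α) = g 0 + Σᵢ αᵢ (g (x^(i)) − g 0)`,
and `V` `L_V`-Lipschitz on a set `S ⊇ g(Ω)`, the distance of `V(θ̃(α))` to the
local Pareto patch `P = V(g(Ω))` is bounded by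
`(L_V η / 2) · maxᵢ‖x^(i)‖² · (√m ‖α‖ + m ‖α‖²)` whenever `X(α) ∈ Ω` and
`θ̃(α) ∈ S`. -/
theorem lle_local_pareto_error
    {m n d : ℕ} (hm : 0 < m)
    (Ω : Set (EuclideanSpace ℝ (Fin m)))
    (hΩopen : IsOpen Ω) (hΩconv : Convex ℝ Ω) (h0 : (0 : EuclideanSpace ℝ (Fin m)) ∈ Ω)
    (g : EuclideanSpace ℝ (Fin m) → EuclideanSpace ℝ (Fin n))
    (η : ℝ)
    (hg : ContDiffOn ℝ 2 g Ω)
    (hD2 : ∀ y ∈ Ω, ‖fderiv ℝ (fderiv ℝ g) y‖ ≤ η)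
    (x : Fin m → EuclideanSpace ℝ (Fin m)) (hx : ∀ i, x i ∈ Ω)
    (S : Set (EuclideanSpace ℝ (Fin n))) (hgS : g '' Ω ⊆ S)
    (LV : ℝ) (hLV : 0 ≤ LV)
    (V : EuclideanSpace ℝ (Fin n) → EuclideanSpace ℝ (Fin d))
    (hVlip : ∀ θ₁ ∈ S, ∀ θ₂ ∈ S, ‖V θ₁ - V θ₂‖ ≤ LV * ‖θ₁ - θ₂‖) :
    ∀ α : EuclideanSpace ℝ (Fin m), (∑ i, α i • x i) ∈ Ω →
      (g 0 + ∑ i, α i • (g (x i) - g 0)) ∈ S →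
      Metric.infDist (V (g 0 + ∑ i, α i • (g (x i) - g 0))) (V '' (g '' Ω)) ≤
        LV * η / 2 *
          (Finset.univ.sup' (Finset.univ_nonempty_iff.mpr (Fin.pos_iff_nonempty.mp hm))
            (fun i => ‖x i‖ ^ 2)) *
          (Real.sqrt m * ‖α‖ + m * ‖α‖ ^ 2) := by
  intro α hX hθ
  have hT := lle_taylor Ω hΩopen hΩconv h0 g η hg hD2
  have hη : 0 ≤ η := le_trans (norm_nonneg (fderiv ℝ (fderiv ℝ g) 0)) (hD2 0 h0)
  set M := Finset.univ.sup' (Finset.univ_nonempty_iff.mpr (Fin.pos_iff_nonempty.mp hm))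
            (fun i => ‖x i‖ ^ 2) with hM
  have hxM : ∀ i, ‖x i‖ ^ 2 ≤ M := fun i =>
    Finset.le_sup' (fun i => ‖x i‖ ^ 2) (Finset.mem_univ i)
  have hM0 : 0 ≤ M := (sq_nonneg _).trans (hxM ⟨0, hm⟩)
  set A := ∑ i, |α i| with hA
  have hA0 : 0 ≤ A := Finset.sum_nonneg fun i _ => abs_nonneg _
  have hA2 : A ^ 2 ≤ m * ‖α‖ ^ 2 := by
    have := sq_sum_le_card_mul_sum_sq (s := Finset.univ) (f := fun i => |α i|)
    rw [EuclideanSpace.norm_sq_eq]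
    simpa using this
  have hA1 : A ≤ Real.sqrt m * ‖α‖ := by
    refine abs_le_of_sq_le_sq' ?_ (by positivity) |>.2
    rw [mul_pow, Real.sq_sqrt (Nat.cast_nonneg m)]
    exact hA2
  have hXn : ‖∑ i, α i • x i‖ ^ 2 ≤ A ^ 2 * M := by
    have : ‖∑ i, α i • x i‖ ≤ A * Real.sqrt M := by
      rw [hA, Finset.sum_mul]
      refine norm_sum_le_of_le _ fun i _ => ?_
      rw [norm_smul, Real.norm_eq_abs]
      gcongr
      exact Real.le_sqrt_of_sq_le (hxM i)
    calc _ ≤ (A * Real.sqrt M) ^ 2 := by gcongr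
      _ = _ := by rw [mul_pow, Real.sq_sqrt hM0]
  have hR : ‖∑ i, α i • (g (x i) - g 0 - fderiv ℝ g 0 (x i))‖ ≤ A * (η / 2 * M) := by
    rw [hA, Finset.sum_mul]
    refine norm_sum_le_of_le _ fun i _ => ?_
    rw [norm_smul, Real.norm_eq_abs]
    gcongr
    exact (hT _ (hx i)).trans (by gcongr; exact hxM i)
  have heq : (g 0 + ∑ i, α i • (g (x i) - g 0)) - g (∑ i, α i • x i) =
      (∑ i, α i • (g (x i) - g 0 - fderiv ℝ g 0 (x i))) -
      (g (∑ i, α i • x i) - g 0 - fderiv ℝ g 0 (∑ i, α i • x i)) := by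
    simp only [smul_sub _ (_ - _) _, Finset.sum_sub_distrib, map_sum, map_smul]
    abel
  have hmain : ‖(g 0 + ∑ i, α i • (g (x i) - g 0)) - g (∑ i, α i • x i)‖ ≤
      η / 2 * M * (Real.sqrt m * ‖α‖ + m * ‖α‖ ^ 2) := by
    rw [heq]
    calc _ ≤ A * (η / 2 * M) + η / 2 * (A ^ 2 * M) :=
          (norm_sub_le _ _).trans (add_le_add hR ((hT _ hX).trans (by gcongr)))
      _ = η / 2 * M * (A + A ^ 2) := by ring
      _ ≤ _ := by gcongr
  calc _ ≤ dist (V (g 0 + ∑ i, α i • (g (x i) - g 0))) (V (g (∑ i, α i • x i))) :=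
        Metric.infDist_le_dist_of_mem
          (Set.mem_image_of_mem V (Set.mem_image_of_mem g hX))
    _ ≤ LV * ‖(g 0 + ∑ i, α i • (g (x i) - g 0)) - g (∑ i, α i • x i)‖ := by
        rw [dist_eq_norm]
        exact hVlip _ hθ _ (hgS ⟨_, hX, rfl⟩)
    _ ≤ LV * (η / 2 * M * (Real.sqrt m * ‖α‖ + m * ‖α‖ ^ 2)) := by gcongr
    _ = _ := by ring
end
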